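/- Let Z ⊆ ℝ^N and W ⊆ ℝ^S be nonempty convex compact sets and let φ : Z × W → ℝ be such that z ↦ φ(z,w) is convex and closed (lower semicontinuous) for each w ∈ W, and w ↦ −φ(z,w) is convex and closed for each z ∈ Z. Then sup_{w ∈ W} inf_{z ∈ Z} φ(z,w) = inf_{z ∈ Z} sup_{w ∈ W} φ(z,w), and the set of saddle points of φ on Z × W is nonempty and compact. -/

import Mathlib

open Set

/-- The sublevel sets common to a nonempty family of lower semicontinuous functions on a compact
set are compact. -/
lemma isCompact_setOf_forall_le_of_lowerSemicontinuousOn {E F : Type*} [TopologicalSpace E]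
    [T2Space E] {X : Set E} {Y : Set F} {f : E → F → ℝ} (hY : Y.Nonempty) (hX : IsCompact X)
    (hf : ∀ y ∈ Y, LowerSemicontinuousOn (fun x => f x y) X) (c : ℝ) :
    IsCompact {x | x ∈ X ∧ ∀ y ∈ Y, f x y ≤ c} := by
  have hK : ∀ y ∈ Y, IsCompact (X ∩ (fun x => f x y) ⁻¹' Iic c) := fun y hy =>
    (hf y hy).isCompact_inter_preimage_Iic hX c
  obtain ⟨y₀, hy₀⟩ := hY
  have hclosed := isClosed_biInter fun y hy => (hK y hy).isClosed
  convert (hK y₀ hy₀).of_isClosed_subset hclosed (biInter_subset_of_mem hy₀) using 1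
  ext x
  simp only [mem_ofPred_eq, mem_iInter, mem_inter_iff, mem_preimage, mem_Iic]
  exact ⟨fun h y hy => ⟨h.1, h.2 y hy⟩, fun h => ⟨(h y₀ hy₀).1, fun y hy => (h y hy).2⟩⟩

/-- A saddle point gives the equality of the lower and upper values. -/
lemma IsSaddlePointOn.sSup_sInf_eq_sInf_sSup {E F : Type*} {X : Set E} {Y : Set F}
    {f : E → F → ℝ} {a : E} {b : F} (ha : a ∈ X) (hb : b ∈ Y) (h : IsSaddlePointOn X Y f a b)
    (hX : ∀ y ∈ Y, BddBelow ((fun x => f x y) '' X))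
    (hY : ∀ x ∈ X, BddAbove ((fun y => f x y) '' Y)) :
    sSup ((fun y => sInf ((fun x => f x y) '' X)) '' Y)
      = sInf ((fun x => sSup ((fun y => f x y) '' Y)) '' X) := by
  have inf_eq : sInf ((fun x => f x b) '' X) = f a b :=
    IsLeast.csInf_eq ⟨mem_image_of_mem _ ha, forall_mem_image.2 fun x hx => h x hx b hb⟩
  have sup_eq : sSup ((fun y => f a y) '' Y) = f a b :=
    IsGreatest.csSup_eq ⟨mem_image_of_mem _ hb, forall_mem_image.2 fun y hy => h a ha y hy⟩
  have lower : IsGreatest ((fun y => sInf ((fun x => f x y) '' X)) '' Y) (f a b) :=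
    ⟨⟨b, hb, inf_eq⟩, forall_mem_image.2 fun y hy =>
      (csInf_le (hX y hy) (mem_image_of_mem _ ha)).trans (h a ha y hy)⟩
  have upper : IsLeast ((fun x => sSup ((fun y => f x y) '' Y)) '' X) (f a b) :=
    ⟨⟨a, ha, sup_eq⟩, forall_mem_image.2 fun x hx =>
      (h x hx b hb).trans (le_csSup (hY x hx) (mem_image_of_mem _ hb))⟩
  rw [lower.csSup_eq, upper.csInf_eq]

/-- Proposition 1, minimax / saddle-point theorem.
Let `Z ⊆ ℝ^N`, `W ⊆ ℝ^S` be nonempty convex compact sets and `φ` such that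
`z ↦ φ z w` is convex and closed (lsc) on `Z` for each `w ∈ W`, and
`w ↦ -φ z w` is convex and closed (lsc) on `W` for each `z ∈ Z`. Then
`sup_{w∈W} inf_{z∈Z} φ = inf_{z∈Z} sup_{w∈W} φ` and the set of saddle points
is nonempty and compact. -/
theorem minimax_saddle_point
    (N S : ℕ)
    (Z : Set (Fin N → ℝ)) (W : Set (Fin S → ℝ))
    (φ : (Fin N → ℝ) → (Fin S → ℝ) → ℝ)
    (hZne : Z.Nonempty) (hZcv : Convex ℝ Z) (hZcp : IsCompact Z)
    (hWne : W.Nonempty) (hWcv : Convex ℝ W) (hWcp : IsCompact W)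
    (hconv : ∀ w ∈ W, ConvexOn ℝ Z (fun z => φ z w) ∧
      LowerSemicontinuousOn (fun z => φ z w) Z)
    (hconc : ∀ z ∈ Z, ConvexOn ℝ W (fun w => -φ z w) ∧
      LowerSemicontinuousOn (fun w => -φ z w) W) :
    sSup ((fun w => sInf ((fun z => φ z w) '' Z)) '' W)
      = sInf ((fun z => sSup ((fun w => φ z w) '' W)) '' Z) ∧
    {p : (Fin N → ℝ) × (Fin S → ℝ) | p.1 ∈ Z ∧ p.2 ∈ W ∧
      ∀ z ∈ Z, ∀ w ∈ W, φ p.1 w ≤ φ p.1 p.2 ∧ φ p.1 p.2 ≤ φ z p.2}.Nonempty ∧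
    IsCompact {p : (Fin N → ℝ) × (Fin S → ℝ) | p.1 ∈ Z ∧ p.2 ∈ W ∧
      ∀ z ∈ Z, ∀ w ∈ W, φ p.1 w ≤ φ p.1 p.2 ∧ φ p.1 p.2 ≤ φ z p.2} := by
  have lsc : ∀ w ∈ W, LowerSemicontinuousOn (fun z => φ z w) Z := fun w hw => (hconv w hw).2
  have usc : ∀ z ∈ Z, UpperSemicontinuousOn (fun w => φ z w) W := fun z hz => by
    simpa [Function.comp_def] using
      continuous_neg.comp_lowerSemicontinuousOn_antitone (hconc z hz).2 fun _ _ => neg_le_neg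
  have concave : ∀ z ∈ Z, ConcaveOn ℝ W (fun w => φ z w) := fun z hz =>
    neg_convexOn_iff.1 (hconc z hz).1
  obtain ⟨a, ha, b, hb, hab⟩ := Sion.exists_isSaddlePointOn hZne hZcv hZcp lsc
    (fun w hw => (hconv w hw).1.quasiconvexOn) hWcv hWne hWcp usc
    (fun z hz => (concave z hz).quasiconcaveOn)
  refine ⟨hab.sSup_sInf_eq_sInf_sSup ha hb (fun w hw => (lsc w hw).bddBelow_of_isCompact hZcp)
    (fun z hz => (usc z hz).bddAbove_of_isCompact hWcp),
    ⟨(a, b), ha, hb, fun z hz w hw => ⟨hab a ha w hw, hab z hz b hb⟩⟩, ?_⟩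
  have hA := isCompact_setOf_forall_le_of_lowerSemicontinuousOn hWne hZcp lsc (φ a b)
  have hB := isCompact_setOf_forall_le_of_lowerSemicontinuousOn (f := fun w z => -φ z w)
    hZne hWcp (fun z hz => (hconc z hz).2) (-φ a b)
  convert hA.prod hB using 1
  ext ⟨z, w⟩
  simp only [mem_ofPred_eq, mem_prod, neg_le_neg_iff]
  constructor
  · rintro ⟨hz, hw, h⟩
    have value : φ z w = φ a b :=
      le_antisymm ((h a ha w hw).2.trans (hab a ha w hw))
        ((hab z hz b hb).trans (h a ha b hb).1)
    exact ⟨⟨hz, fun w' hw' => value ▸ (h a ha w' hw').1⟩,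
      ⟨hw, fun z' hz' => value ▸ (h z' hz' b hb).2⟩⟩
  · rintro ⟨⟨hz, hA⟩, ⟨hw, hB⟩⟩
    exact ⟨hz, hw, fun z' hz' w' hw' =>
      ⟨(hA w' hw').trans (hB z hz), (hA w hw).trans (hB z' hz')⟩⟩
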